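/- Dworkin's statistic gives the q-hit polynomials: for any Ferrers board B in the n×n grid, T_k(B;q) = Σ_C q^{ξ(C,B)}, where the sum is over placements C of n non-attacking rooks on the full n×n grid with exactly k rooks on B, and ξ(C,B) counts: for each rook on B, the empty cells of B strictly below it in its column; and for each rook off B, the empty cells strictly below it in its column together with the empty cells of B strictly above it in its column; where a cell is 'empty' if it contains no rook and is not to the right of any rook in its row. -/

import Mathlib

open Finset
open scoped Classical

noncomputable section

variable {R : Type*} [CommRing R]

/-- The q-integer `[m]_q = 1 + q + ... + q^{m-1}`. -/
def qint (q : R) (m : ℕ) : R := ∑ i ∈ Finset.range m, q ^ i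

/-- The q-factorial `[m]_q!`. -/
def qfact (q : R) (m : ℕ) : R := ∏ i ∈ Finset.range m, qint q (i + 1)

/-- A Ferrers board inside the `n × n` grid, given by column heights `c`:
square `(i,j)` (0-based row `i`, column `j`) belongs to the board iff `i < c j`. -/
def IsFerrers (n : ℕ) (c : Fin n → ℕ) : Prop := Monotone c ∧ ∀ j, c j ≤ n

/-- The squares of the Ferrers board with column heights `c`. -/
def boardSq (n : ℕ) (c : Fin n → ℕ) : Finset (Fin n × Fin n) :=
  Finset.univ.filter fun s => (s.1 : ℕ) < c s.2

/-- A set of rooks is non-attacking when no two share a row or a column. -/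
def NonAttacking {n : ℕ} (C : Finset (Fin n × Fin n)) : Prop :=
  ∀ r ∈ C, ∀ r' ∈ C, r ≠ r' → r.1 ≠ r'.1 ∧ r.2 ≠ r'.2

/-- Placements of `k` non-attacking rooks on the Ferrers board. -/
def placements (n : ℕ) (c : Fin n → ℕ) (k : ℕ) : Finset (Finset (Fin n × Fin n)) :=
  Finset.univ.filter fun C => C.card = k ∧ C ⊆ boardSq n c ∧ NonAttacking C

/-- `inv(C,B)`: the number of squares of the board that do not contain a rook and
are not above (smaller row index, same column) nor to the right of (same row,
larger column index) any rook of `C`. -/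
def rookInv (n : ℕ) (c : Fin n → ℕ) (C : Finset (Fin n × Fin n)) : ℕ :=
  ((boardSq n c).filter fun s => s ∉ C ∧ ∀ r ∈ C,
    ¬(r.2 = s.2 ∧ s.1 < r.1) ∧ ¬(r.1 = s.1 ∧ r.2 < s.2)).card

/-- The Garsia–Remmel q-rook polynomial `R_k(B;q)`. -/
def qRook (q : R) (n : ℕ) (c : Fin n → ℕ) (k : ℕ) : R :=
  ∑ C ∈ placements n c k, q ^ rookInv n c C

/-- The polynomial (in `x`) `∑_{j=0}^n [j]_q! R_{n-j}(B;q) ∏_{i=j+1}^n (x - q^i)`. -/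
def hitGen (q : R) (n : ℕ) (c : Fin n → ℕ) : Polynomial R :=
  ∑ j ∈ Finset.range (n + 1),
    Polynomial.C (qfact q j * qRook q n c (n - j)) *
      ∏ i ∈ Finset.Icc (j + 1) n, (Polynomial.X - Polynomial.C (q ^ i))

/-- The Garsia–Remmel q-hit polynomial `T_k(B;q)`, defined by
`∑_{j=0}^n [j]_q! R_{n-j}(B;q) ∏_{i=j+1}^n (x - q^i) = ∑_k T_k(B;q) x^k`. -/
def qHit (q : R) (n : ℕ) (c : Fin n → ℕ) (k : ℕ) : R := (hitGen q n c).coeff k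

/-- Placements of `n` non-attacking rooks on the full `n × n` grid with exactly
`k` rooks on the board. -/
def fullPlacements (n : ℕ) (c : Fin n → ℕ) (k : ℕ) : Finset (Finset (Fin n × Fin n)) :=
  Finset.univ.filter fun C => C.card = n ∧ NonAttacking C ∧ (C ∩ boardSq n c).card = k

end

/-- A cell is empty if it contains no rook and is not to the right of a rook in its row. -/
def IsEmptyCell {n : ℕ} (C : Finset (Fin n × Fin n)) (s : Fin n × Fin n) : Prop :=
  s ∉ C ∧ ∀ r ∈ C, ¬(r.1 = s.1 ∧ r.2 < s.2)

open scoped Classical in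
/-- Dworkin's statistic `ξ(C,B)`. -/
noncomputable def xiStat (n : ℕ) (c : Fin n → ℕ) (C : Finset (Fin n × Fin n)) : ℕ :=
  ∑ r ∈ C,
    if r ∈ boardSq n c then
      ((boardSq n c).filter fun s => s.2 = r.2 ∧ r.1 < s.1 ∧ IsEmptyCell C s).card
    else
      ((Finset.univ : Finset (Fin n × Fin n)).filter
          fun s => s.2 = r.2 ∧ r.1 < s.1 ∧ IsEmptyCell C s).card +
        ((boardSq n c).filter fun s => s.2 = r.2 ∧ s.1 < r.1 ∧ IsEmptyCell C s).card

/-- The `q`-rook numbers of the board with column heights `c 0, …, c (N - 1)`, computed by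
expanding along the first column. -/
def rookNum {R : Type*} [CommRing R] (q : R) : ℕ → (ℕ → ℕ) → ℕ → R
  | 0, _, m => if m = 0 then 1 else 0
  | N + 1, c, 0 => q ^ c 0 * rookNum q N (fun i => c (i + 1)) 0
  | N + 1, c, m + 1 =>
      qint q (c 0) * rookNum q N (fun i => c (i + 1) - 1) m +
        q ^ c 0 * rookNum q N (fun i => c (i + 1)) (m + 1)

/-- Column heights after deleting row `r`. -/
def delRow (r : ℕ) (c : ℕ → ℕ) (i : ℕ) : ℕ := if r < c i then c i - 1 else c i

theorem rookNum_eq_zero {R : Type*} [CommRing R] (q : R) (N : ℕ) (c : ℕ → ℕ) (m : ℕ)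
    (h : N < m) : rookNum q N c m = 0 := by
  induction N generalizing c m with
  | zero => simp [rookNum]; omega
  | succ N ih =>
    obtain ⟨m, rfl⟩ : ∃ m', m = m' + 1 := ⟨m - 1, by omega⟩
    simp [rookNum, ih _ m (by omega), ih _ (m + 1) (by omega)]

theorem qint_zero {R : Type*} [CommRing R] (q : R) : qint q 0 = 0 := by simp [qint]

theorem sum_pow_reflect {R : Type*} [CommRing R] (q : R) (n : ℕ) :
    ∑ r ∈ Finset.range n, q ^ (n - 1 - r) = qint q n :=
  Finset.sum_range_reflect (fun i => q ^ i) n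

theorem sum_pow_sub {R : Type*} [CommRing R] (q : R) {n d : ℕ} (h : d ≤ n) :
    ∑ r ∈ Finset.range d, q ^ (n - 1 - r) = q ^ (n - d) * qint q d := by
  rw [← sum_pow_reflect, Finset.mul_sum]
  refine Finset.sum_congr rfl fun r hr => ?_
  rw [Finset.mem_range] at hr
  rw [← pow_add]
  congr 1
  omega

theorem delRow_of_lt {r : ℕ} {c : ℕ → ℕ} (h : ∀ i, r < c i) :
    delRow r c = fun i => c i - 1 := by
  funext i; simp [delRow, h i]

theorem sum_delRow_Ico {R : Type*} [CommRing R] (q : R) {n d : ℕ} (h : d ≤ n) {c : ℕ → ℕ}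
    (hc : ∀ i, d ≤ c i) (f : (ℕ → ℕ) → R) :
    ∑ r ∈ Finset.Ico d n, q ^ (n - 1 - r) * f (delRow r c) =
      ∑ r ∈ Finset.range n, q ^ (n - 1 - r) * f (delRow r c) -
        q ^ (n - d) * qint q d * f (fun i => c i - 1) := by
  rw [Finset.sum_Ico_eq_sub _ h, ← sum_pow_sub q h, Finset.sum_mul]
  congr 1
  refine Finset.sum_congr rfl fun r hr => ?_
  rw [Finset.mem_range] at hr
  rw [delRow_of_lt fun i => lt_of_lt_of_le hr (hc i)]

theorem sum_rookNum_delRow {R : Type*} [CommRing R] (q : R) (N n : ℕ) (c : ℕ → ℕ)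
    (hc : Monotone c) (hn : ∀ i, c i ≤ n) (m : ℕ) :
    ∑ r ∈ Finset.range n, q ^ (n - 1 - r) * rookNum q N (delRow r c) m =
      qint q (n - m) * rookNum q N c m +
        (q ^ (n - m - 1) - q ^ n) * rookNum q N c (m + 1) := by
  induction N generalizing n c m with
  | zero =>
    rcases m with _ | m
    · simp [rookNum, sum_pow_reflect]
    · simp [rookNum]
  | succ N ih =>
    have hd := hn 0
    have hle : ∀ i, c 0 ≤ c (i + 1) := fun i => hc (Nat.zero_le _)
    have hmono : Monotone fun i => c (i + 1) := fun a b h => hc (by omega)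
    have hmono' : Monotone fun i => c (i + 1) - 1 :=
      fun a b h => Nat.sub_le_sub_right (hmono h) 1
    have hlow (m : ℕ) : ∑ r ∈ Finset.range (c 0),
        q ^ (n - 1 - r) * rookNum q (N + 1) (delRow r c) m =
        q ^ (n - c 0) * qint q (c 0) * rookNum q (N + 1) (fun i => c i - 1) m := by
      rw [← sum_pow_sub q hd, Finset.sum_mul]
      refine Finset.sum_congr rfl fun r hr => ?_
      rw [Finset.mem_range] at hr
      rw [delRow_of_lt fun i => lt_of_lt_of_le hr (hc (Nat.zero_le i))]
    have hA (m : ℕ) := sum_delRow_Ico q hd hle (fun l => rookNum q N l m)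
    have hhead (r : ℕ) (hr : r ∈ Finset.Ico (c 0) n) : delRow r c 0 = c 0 := by
      rw [Finset.mem_Ico] at hr
      simp [delRow]; omega
    have htail (r : ℕ) :
        (fun i => delRow r c (i + 1)) = delRow r (fun i => c (i + 1)) := rfl
    rw [← Finset.sum_range_add_sum_Ico _ hd, hlow]
    rcases m with _ | m
    · have e1 : ∑ r ∈ Finset.Ico (c 0) n,
          q ^ (n - 1 - r) * rookNum q (N + 1) (delRow r c) 0 =
          q ^ c 0 * ∑ r ∈ Finset.Ico (c 0) n,
            q ^ (n - 1 - r) * rookNum q N (delRow r fun i => c (i + 1)) 0 := by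
        rw [Finset.mul_sum]
        refine Finset.sum_congr rfl fun r hr => ?_
        rw [rookNum, hhead r hr, htail]; ring
      rw [e1, hA, ih n _ hmono (fun i => hn _)]
      rcases Nat.eq_zero_or_pos (c 0) with h0 | h0
      · simp [rookNum, h0, qint_zero]
      · obtain ⟨d, hd'⟩ : ∃ d, c 0 = d + 1 := ⟨c 0 - 1, by omega⟩
        obtain ⟨t, rfl⟩ : ∃ t, n = t + (d + 1) := ⟨n - (d + 1), by omega⟩
        simp only [rookNum, hd', Nat.add_sub_cancel, Nat.sub_zero, zero_add,
          show t + (d + 1) - 1 = t + d by omega]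
        ring
    · rcases Nat.eq_zero_or_pos (c 0) with h0 | h0
      · have e1 : ∑ r ∈ Finset.Ico (c 0) n,
            q ^ (n - 1 - r) * rookNum q (N + 1) (delRow r c) (m + 1) =
            ∑ r ∈ Finset.Ico (c 0) n,
              q ^ (n - 1 - r) * rookNum q N (delRow r fun i => c (i + 1)) (m + 1) := by
          refine Finset.sum_congr rfl fun r hr => ?_
          rw [rookNum, hhead r hr, htail, h0, qint_zero]; simp
        rw [e1, hA, ih n _ hmono (fun i => hn _)]
        simp [rookNum, h0, qint_zero]
      · obtain ⟨d, hd'⟩ : ∃ d, c 0 = d + 1 := ⟨c 0 - 1, by omega⟩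
        obtain ⟨t, rfl⟩ : ∃ t, n = t + (d + 1) := ⟨n - (d + 1), by omega⟩
        have hB := sum_delRow_Ico q (n := t + d) (d := d) (by omega)
          (c := fun i => c (i + 1) - 1) (fun i => by have := hle i; omega)
          (fun l => rookNum q N l m)
        have e1 : ∑ r ∈ Finset.Ico (c 0) (t + (d + 1)),
            q ^ (t + (d + 1) - 1 - r) * rookNum q (N + 1) (delRow r c) (m + 1) =
            qint q (d + 1) * ∑ r ∈ Finset.Ico d (t + d),
              q ^ (t + d - 1 - r) * rookNum q N (delRow r fun i => c (i + 1) - 1) m +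
            q ^ (d + 1) * ∑ r ∈ Finset.Ico (c 0) (t + (d + 1)),
              q ^ (t + (d + 1) - 1 - r) *
                rookNum q N (delRow r fun i => c (i + 1)) (m + 1) := by
          have hs : ∑ r ∈ Finset.Ico d (t + d),
              q ^ (t + d - 1 - r) * rookNum q N (delRow r fun i => c (i + 1) - 1) m =
              ∑ r ∈ Finset.Ico (c 0) (t + (d + 1)),
                q ^ (t + (d + 1) - 1 - r) *
                  rookNum q N (delRow (r - 1) fun i => c (i + 1) - 1) m := by
            rw [hd', ← add_assoc, ← Finset.sum_Ico_add']
            refine Finset.sum_congr rfl fun r hr => ?_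
            rw [Nat.add_sub_cancel]
            congr 2
            omega
          rw [hs, Finset.mul_sum, Finset.mul_sum, ← Finset.sum_add_distrib]
          refine Finset.sum_congr rfl fun r hr => ?_
          rw [rookNum, hhead r hr, htail, hd']
          have : (fun i => delRow r c (i + 1) - 1) =
              delRow (r - 1) fun i => c (i + 1) - 1 := by
            funext i
            rw [Finset.mem_Ico] at hr
            simp only [delRow]
            split_ifs <;> omega
          rw [this]; ring
        rw [e1, hA, hB, ih _ _ hmono (fun i => hn _),
          ih _ _ hmono' (fun i => by have := hn (i + 1); omega)]
        simp only [rookNum, hd', Nat.add_sub_cancel,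
          show t + (d + 1) - (m + 1) = t + d - m by omega]
        ring

/-- The `q`-hit polynomial of the board with column heights `c 0, …, c (N - 1)`. -/
noncomputable def hitPoly {R : Type*} [CommRing R] (q : R) (N : ℕ) (c : ℕ → ℕ) :
    Polynomial R :=
  ∑ j ∈ Finset.range (N + 1),
    Polynomial.C (qfact q j * rookNum q N c (N - j)) *
      ∏ i ∈ Finset.Icc (j + 1) N, (Polynomial.X - Polynomial.C (q ^ i))

theorem qfact_succ {R : Type*} [CommRing R] (q : R) (m : ℕ) :
    qfact q (m + 1) = qfact q m * qint q (m + 1) := by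
  simp [qfact, Finset.prod_range_succ]

theorem sum_qfact_mul_rookNum {R : Type*} [CommRing R] (q : R) (N : ℕ) (c : ℕ → ℕ) :
    ∑ j ∈ Finset.range (N + 1), Polynomial.C (qfact q j * rookNum q N c (N + 1 - j)) *
        ((∏ i ∈ Finset.Icc (j + 1) N, (Polynomial.X - Polynomial.C (q ^ i))) *
          (Polynomial.X - Polynomial.C (q ^ j))) +
      Polynomial.C (qfact q (N + 1) * rookNum q N c 0) =
    ∑ j ∈ Finset.range (N + 1), Polynomial.C (qfact q (j + 1) * rookNum q N c (N - j)) *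
        ∏ i ∈ Finset.Icc (j + 1) N, (Polynomial.X - Polynomial.C (q ^ i)) := by
  rw [Finset.sum_range_succ', Finset.sum_range_succ _ N]
  simp only [Nat.sub_zero, rookNum_eq_zero q N c (N + 1) (by omega), mul_zero, map_zero,
    zero_mul, add_zero, Nat.sub_self]
  congr 1
  · refine Finset.sum_congr rfl fun j hj => ?_
    rw [Finset.mem_range] at hj
    rw [show N + 1 - (j + 1) = N - j by omega,
      ← Finset.mul_prod_Ioc_eq_prod_Icc (a := j + 1) (b := N) (by omega),
      show Finset.Ioc (j + 1) N = Finset.Icc (j + 1 + 1) N by ext; simp]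
    ring
  · simp

theorem hitPoly_succ {R : Type*} [CommRing R] (q : R) (N : ℕ) (c : ℕ → ℕ)
    (hc : Monotone c) (hn : ∀ i, c i ≤ N + 1) :
    hitPoly q (N + 1) c =
      Polynomial.X * Polynomial.C (qint q (c 0)) * hitPoly q N (fun i => c (i + 1) - 1) +
      ∑ r ∈ Finset.Ico (c 0) (N + 1),
        Polynomial.C (q ^ (c 0 + (N - r))) * hitPoly q N (delRow r fun i => c (i + 1)) := by
  have hle : ∀ i, c 0 ≤ c (i + 1) := fun i => hc (Nat.zero_le _)
  have hmono : Monotone fun i => c (i + 1) := fun a b h => hc (by omega)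
  have key (k : ℕ) (hk : k ∈ Finset.range (N + 1)) :
      ∑ r ∈ Finset.Ico (c 0) (N + 1),
        q ^ (c 0 + (N - r)) * rookNum q N (delRow r fun i => c (i + 1)) (N - k) =
      q ^ c 0 * (qint q (k + 1) * rookNum q N (fun i => c (i + 1)) (N - k) +
        (q ^ k - q ^ (N + 1)) * rookNum q N (fun i => c (i + 1)) (N + 1 - k)) -
      q ^ (N + 1) * qint q (c 0) * rookNum q N (fun i => c (i + 1) - 1) (N - k) := by
    rw [Finset.mem_range] at hk
    have h1 := sum_delRow_Ico q (hn 0) hle (fun l => rookNum q N l (N - k))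
    rw [sum_rookNum_delRow q N (N + 1) _ hmono (fun i => hn _),
      show N + 1 - (N - k) = k + 1 by omega, show N - k + 1 = N + 1 - k by omega] at h1
    simp only [Nat.add_sub_cancel] at h1
    have h2 : q ^ (N + 1) = q ^ c 0 * q ^ (N + 1 - c 0) := by
      rw [← pow_add]; congr 1; have := hn 0; omega
    simp only [pow_add q (c 0), mul_assoc, ← Finset.mul_sum]
    rw [h1]
    nth_rw 3 [h2]
    ring
  have hswap : ∑ r ∈ Finset.Ico (c 0) (N + 1),
        Polynomial.C (q ^ (c 0 + (N - r))) * hitPoly q N (delRow r fun i => c (i + 1)) =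
      ∑ k ∈ Finset.range (N + 1), Polynomial.C (qfact q k *
        (q ^ c 0 * (qint q (k + 1) * rookNum q N (fun i => c (i + 1)) (N - k) +
        (q ^ k - q ^ (N + 1)) * rookNum q N (fun i => c (i + 1)) (N + 1 - k)) -
        q ^ (N + 1) * qint q (c 0) * rookNum q N (fun i => c (i + 1) - 1) (N - k))) *
        ∏ i ∈ Finset.Icc (k + 1) N, (Polynomial.X - Polynomial.C (q ^ i)) := by
    simp only [hitPoly, Finset.mul_sum]
    rw [Finset.sum_comm]
    refine Finset.sum_congr rfl fun k hk => ?_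
    rw [← key k hk, Finset.mul_sum, map_sum, Finset.sum_mul]
    refine Finset.sum_congr rfl fun r _ => ?_
    simp only [map_mul]
    ring
  have hA := congrArg (fun p => Polynomial.C (q ^ c 0) * p)
    (sum_qfact_mul_rookNum q N fun i => c (i + 1))
  simp only [mul_add, Finset.mul_sum] at hA
  rw [hswap, hitPoly, Finset.sum_range_succ, Nat.sub_self, hitPoly, Finset.mul_sum,
    ← Finset.sum_add_distrib]
  have hlast : Polynomial.C (qfact q (N + 1) * rookNum q (N + 1) c 0) *
      ∏ i ∈ Finset.Icc (N + 1 + 1) (N + 1), (Polynomial.X - Polynomial.C (q ^ i)) =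
      Polynomial.C (q ^ c 0) *
        Polynomial.C (qfact q (N + 1) * rookNum q N (fun i => c (i + 1)) 0) := by
    simp [rookNum]; ring
  rw [hlast, ← sub_eq_iff_eq_add'.mpr hA.symm, ← Finset.sum_sub_distrib,
    ← Finset.sum_add_distrib]
  refine Finset.sum_congr rfl fun k hk => ?_
  rw [Finset.mem_range] at hk
  rw [Finset.prod_Icc_succ_top (by omega : k + 1 ≤ N + 1),
    show N + 1 - k = (N - k) + 1 by omega, rookNum, qfact_succ]
  simp only [map_mul, map_add, map_sub, map_pow]
  ring

/-- The number of rows `r < a` outside the set `U` of occupied rows. -/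
def freeRows (U : Finset ℕ) (a : ℕ) : ℕ := ((Finset.range a).filter fun r => r ∉ U).card

theorem freeRows_succ (U : Finset ℕ) (a : ℕ) :
    freeRows U (a + 1) = freeRows U a + if a ∈ U then 0 else 1 := by
  unfold freeRows
  rw [Finset.range_add_one, Finset.filter_insert]
  split_ifs <;> simp_all

theorem freeRows_mono (U : Finset ℕ) : Monotone (freeRows U) := fun _ _ h =>
  Finset.card_le_card (Finset.filter_subset_filter _ (Finset.range_subset_range.2 h))

theorem freeRows_lt_iff {U : Finset ℕ} {p : ℕ} (hp : p ∉ U) (a : ℕ) :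
    freeRows U p < freeRows U a ↔ p < a := by
  refine ⟨fun h => ?_, fun h => ?_⟩
  · by_contra! h'
    exact absurd (freeRows_mono U h') (by omega)
  · have h1 := freeRows_mono U h
    have h2 := freeRows_succ U p
    simp only [hp, if_false] at h2
    simp only [Nat.succ_eq_add_one] at h1
    omega

theorem freeRows_insert {U : Finset ℕ} {p : ℕ} (hp : p ∉ U) (a : ℕ) :
    freeRows (insert p U) a = if p < a then freeRows U a - 1 else freeRows U a := by
  have h : ((Finset.range a).filter fun r => r ∉ insert p U) =
      ((Finset.range a).filter fun r => r ∉ U).erase p := by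
    ext r; simp; tauto
  rw [freeRows, h]
  split_ifs with hpa
  · exact Finset.card_erase_of_mem (by simp [hp, hpa])
  · rw [Finset.erase_eq_of_notMem (by simp [hpa])]; rfl

theorem freeRows_eq_sub {U : Finset ℕ} {a : ℕ} (h : U ⊆ Finset.range a) :
    freeRows U a = a - U.card := by
  have : ((Finset.range a).filter fun r => r ∉ U) = Finset.range a \ U := by ext; simp
  rw [freeRows, this, Finset.card_sdiff_of_subset h, Finset.card_range]

theorem freeRows_empty (a : ℕ) : freeRows ∅ a = a := by simp [freeRows]

theorem freeRows_comp_insert {U : Finset ℕ} {p : ℕ} (hp : p ∉ U) (h : ℕ → ℕ) :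
    (fun i => freeRows (insert p U) (h i)) =
      delRow (freeRows U p) fun i => freeRows U (h i) := by
  funext i
  simp only [delRow, freeRows_insert hp, freeRows_lt_iff hp]

theorem sum_freeRows {M : Type*} [AddCommMonoid M] (U : Finset ℕ) (g : ℕ → M) (a : ℕ) :
    ∑ p ∈ (Finset.range a).filter (fun r => r ∉ U), g (freeRows U p) =
      ∑ r ∈ Finset.range (freeRows U a), g r := by
  induction a with
  | zero => simp [freeRows]
  | succ a ih =>
    rw [Finset.range_add_one, Finset.filter_insert, freeRows_succ]
    split_ifs with h
    · simp [h] at h ⊢; simpa using ih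
    all_goals simp_all [Finset.sum_range_succ, add_comm]

theorem sum_fin_freeRows {M : Type*} [AddCommMonoid M] {n : ℕ} (U : Finset ℕ) (g : ℕ → M) :
    ∑ p ∈ (Finset.univ : Finset (Fin n)).filter (fun p : Fin n => (p : ℕ) ∉ U),
        g (freeRows U (p : ℕ)) = ∑ r ∈ Finset.range (freeRows U n), g r := by
  rw [← sum_freeRows, Finset.sum_filter, Finset.sum_filter,
    ← Fin.sum_univ_eq_sum_range (fun p => if p ∉ U then g (freeRows U p) else 0)]

/-- Counting the free cells of column `j` lying in the rows selected by `P`. -/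
theorem card_column {n : ℕ} (j : Fin n) (P : ℕ → Prop) [DecidablePred P]
    (S : Finset (Fin n × Fin n)) (hS : ∀ s, s ∈ S ↔ s.2 = j ∧ P s.1) :
    S.card = ((Finset.range n).filter P).card := by
  refine Finset.card_bij (fun s _ => (s.1 : ℕ)) ?_ ?_ ?_
  · intro s hs
    simp [((hS s).1 hs).2]
  · intro s hs t ht h
    exact Prod.ext (Fin.ext h) (((hS s).1 hs).1.trans ((hS t).1 ht).1.symm)
  · intro r hr
    rw [Finset.mem_filter, Finset.mem_range] at hr
    exact ⟨(⟨r, hr.1⟩, j), (hS _).2 ⟨rfl, hr.2⟩, rfl⟩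

theorem card_free_lt {n a : ℕ} (ha : a ≤ n) (U : Finset ℕ) :
    ((Finset.range n).filter fun r => r < a ∧ r ∉ U).card = freeRows U a := by
  unfold freeRows
  congr 1
  ext r
  simp
  omega

theorem card_free_between {n a p : ℕ} (ha : a ≤ n) {U : Finset ℕ} (hp : p ∉ U) :
    ((Finset.range n).filter fun r => p < r ∧ r < a ∧ r ∉ U).card =
      freeRows U a - 1 - freeRows U p := by
  rcases lt_or_ge p a with hpa | hpa
  · have h : ((Finset.range a).filter fun r => r ∉ U) =
        ((Finset.range n).filter fun r => p < r ∧ r < a ∧ r ∉ U) ∪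
          ((Finset.range (p + 1)).filter fun r => r ∉ U) := by
      ext r
      simp only [Finset.mem_filter, Finset.mem_range, Finset.mem_union]
      by_cases hr : r ∈ U <;> simp [hr]
      omega
    have hd : Disjoint ((Finset.range n).filter fun r => p < r ∧ r < a ∧ r ∉ U)
        ((Finset.range (p + 1)).filter fun r => r ∉ U) := by
      rw [Finset.disjoint_left]
      intro r
      simp only [Finset.mem_filter, Finset.mem_range]
      omega
    have h1 := congrArg Finset.card h
    rw [Finset.card_union_of_disjoint hd] at h1
    have h2 := freeRows_succ U p
    simp only [hp, if_false] at h2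
    unfold freeRows at h2 ⊢
    omega
  · have := freeRows_mono U hpa
    rw [Finset.card_eq_zero.2, show freeRows U a - 1 - freeRows U p = 0 by omega]
    rw [Finset.filter_eq_empty_iff]
    intro r _
    omega

theorem nonAttacking_insert {n : ℕ} {p j : Fin n} {C : Finset (Fin n × Fin n)}
    (h : ∀ r ∈ C, r.1 ≠ p ∧ r.2 ≠ j) :
    NonAttacking (insert (p, j) C) ↔ NonAttacking C := by
  refine ⟨fun H r hr r' hr' => H r (Finset.mem_insert_of_mem hr) r'
    (Finset.mem_insert_of_mem hr'), fun H r hr r' hr' hne => ?_⟩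
  rcases Finset.mem_insert.1 hr with rfl | hr <;>
    rcases Finset.mem_insert.1 hr' with rfl | hr'
  · exact absurd rfl hne
  · exact ⟨(h r' hr').1.symm, (h r' hr').2.symm⟩
  · exact h r hr
  · exact H r hr r' hr' hne

/-- Non-attacking placements in the columns `≥ j`, avoiding the rows in `U`. -/
noncomputable def tailPlacements (n j : ℕ) (U : Finset ℕ) :
    Finset (Finset (Fin n × Fin n)) :=
  Finset.univ.filter fun C => NonAttacking C ∧ ∀ r ∈ C, j ≤ (r.2 : ℕ) ∧ (r.1 : ℕ) ∉ U

theorem mem_tailPlacements {n j : ℕ} {U : Finset ℕ} {C : Finset (Fin n × Fin n)} :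
    C ∈ tailPlacements n j U ↔
      NonAttacking C ∧ ∀ r ∈ C, j ≤ (r.2 : ℕ) ∧ (r.1 : ℕ) ∉ U := by
  simp [tailPlacements]

theorem tailPlacements_of_le {n j : ℕ} (h : n ≤ j) (U : Finset ℕ) :
    tailPlacements n j U = {∅} := by
  ext C
  rw [mem_tailPlacements, Finset.mem_singleton]
  refine ⟨fun hC => Finset.eq_empty_of_forall_notMem fun r hr => ?_, ?_⟩
  · have := (hC.2 r hr).1
    omega
  · rintro rfl
    simp [NonAttacking]

theorem notMem_of_tailPlacements {n : ℕ} {p j : Fin n} {U : Finset ℕ}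
    {C : Finset (Fin n × Fin n)} (hC : C ∈ tailPlacements n (j + 1) U) : (p, j) ∉ C :=
  fun h => by
    have := ((mem_tailPlacements.1 hC).2 _ h).1
    simp at this

theorem insert_mem_tailPlacements {n : ℕ} {p j : Fin n} {U : Finset ℕ}
    {C : Finset (Fin n × Fin n)} (hp : (p : ℕ) ∉ U)
    (hC : C ∈ tailPlacements n (j + 1) (insert (p : ℕ) U)) :
    insert (p, j) C ∈ tailPlacements n j U := by
  rw [mem_tailPlacements] at hC ⊢
  have h (r) (hr : r ∈ C) : r.1 ≠ p ∧ r.2 ≠ j := by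
    have := hC.2 r hr
    simp only [Finset.mem_insert, not_or] at this
    refine ⟨fun e => this.2.1 (by rw [e]), fun e => ?_⟩
    rw [e] at this
    omega
  refine ⟨(nonAttacking_insert h).2 hC.1, fun r hr => ?_⟩
  rcases Finset.mem_insert.1 hr with rfl | hr
  · exact ⟨le_rfl, hp⟩
  · have := hC.2 r hr
    simp only [Finset.mem_insert, not_or] at this
    exact ⟨by omega, this.2.2⟩

theorem sum_tailPlacements {M : Type*} [AddCommMonoid M] {n : ℕ} (j : Fin n) (U : Finset ℕ)
    (f : Finset (Fin n × Fin n) → M) :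
    ∑ C ∈ tailPlacements n j U, f C =
      ∑ C ∈ tailPlacements n (j + 1) U, f C +
      ∑ p ∈ (Finset.univ : Finset (Fin n)).filter (fun p : Fin n => (p : ℕ) ∉ U),
        ∑ C ∈ tailPlacements n (j + 1) (insert (p : ℕ) U), f (insert (p, j) C) := by
  rw [← Finset.sum_filter_add_sum_filter_not (tailPlacements n j U)
    (fun C => ∀ r ∈ C, (j : ℕ) + 1 ≤ r.2)]
  congr 1
  · refine Finset.sum_congr ?_ fun _ _ => rfl
    ext C
    simp only [Finset.mem_filter, mem_tailPlacements]
    refine ⟨fun h => ⟨h.1.1, fun r hr => ⟨h.2 r hr, (h.1.2 r hr).2⟩⟩, fun h =>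
      ⟨⟨h.1, fun r hr => ⟨by have := (h.2 r hr).1; omega, (h.2 r hr).2⟩⟩,
        fun r hr => (h.2 r hr).1⟩⟩
  · rw [Finset.sum_sigma']
    symm
    refine Finset.sum_bij (fun x _ => insert (x.1, j) x.2) ?_ ?_ ?_ (fun _ _ => rfl)
    · rintro ⟨p, C⟩ h
      simp only [Finset.mem_sigma, Finset.mem_filter, Finset.mem_univ, true_and] at h ⊢
      refine ⟨insert_mem_tailPlacements h.1 h.2, fun H => ?_⟩
      have := H _ (Finset.mem_insert_self _ _)
      simp at this
    · rintro ⟨p, C⟩ h ⟨p', C'⟩ h' e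
      simp only [Finset.mem_sigma, Finset.mem_filter, Finset.mem_univ, true_and] at h h' e
      have hp : p = p' := by
        have : (p, j) ∈ insert (p', j) C' := e ▸ Finset.mem_insert_self _ _
        rcases Finset.mem_insert.1 this with h1 | h1
        · exact (Prod.ext_iff.1 h1).1
        · exact absurd h1 (notMem_of_tailPlacements h'.2)
      subst hp
      have : C = C' := by
        rw [← Finset.erase_insert (notMem_of_tailPlacements (p := p) h.2), e,
          Finset.erase_insert (notMem_of_tailPlacements h'.2)]
      rw [this]
    · intro C hC
      simp only [Finset.mem_filter, mem_tailPlacements, not_forall] at hC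
      obtain ⟨⟨hN, hU⟩, ⟨p, j'⟩, hr, hj⟩ := hC
      have hjj : j' = j := Fin.ext (by have := (hU _ hr).1; simp at this hj; omega)
      subst hjj
      refine ⟨⟨p, C.erase (p, j')⟩, ?_, Finset.insert_erase hr⟩
      simp only [Finset.mem_sigma, Finset.mem_filter, Finset.mem_univ, true_and,
        mem_tailPlacements]
      refine ⟨(hU _ hr).2, fun r h r' h' => hN r (Finset.mem_of_mem_erase h) r'
        (Finset.mem_of_mem_erase h'), fun r h => ?_⟩
      obtain ⟨hne, hrC⟩ := Finset.mem_erase.1 h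
      have h1 := hN r hrC _ hr hne
      have h2 := hU r hrC
      simp only [Finset.mem_insert, not_or]
      refine ⟨?_, fun e => h1.1 (Fin.ext e), h2.2⟩
      have h3 : (r.2 : ℕ) ≠ j' := fun e => h1.2 (Fin.ext e)
      omega

theorem card_le_of_mem_tailPlacements {n j : ℕ} {U : Finset ℕ} {C : Finset (Fin n × Fin n)}
    (hC : C ∈ tailPlacements n j U) : C.card ≤ n - j := by
  rw [mem_tailPlacements] at hC
  rw [← Nat.card_Ico j n]
  refine Finset.card_le_card_of_injOn (fun r => (r.2 : ℕ)) (fun r hr => ?_) ?_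
  · simp [(hC.2 r hr).1]
  · intro r hr r' hr' e
    by_contra hne
    exact (hC.1 r hr r' hr' hne).2 (Fin.ext e)

theorem mem_boardSq {n : ℕ} {c : Fin n → ℕ} {s : Fin n × Fin n} :
    s ∈ boardSq n c ↔ (s.1 : ℕ) < c s.2 := by
  simp [boardSq]

theorem isEmptyCell_insert_of_column {n : ℕ} {p j : Fin n} {U : Finset ℕ}
    {C : Finset (Fin n × Fin n)} (hC : C ∈ tailPlacements n (j + 1) U)
    {s : Fin n × Fin n} (hs : s.2 = j) :
    IsEmptyCell (insert (p, j) C) s ↔ s.1 ≠ p := by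
  obtain ⟨a, b⟩ := s
  simp only at hs
  subst hs
  have hlt (r) (hr : r ∈ C) : b < r.2 := ((mem_tailPlacements.1 hC).2 r hr).1
  simp only [IsEmptyCell, Finset.mem_insert, not_or, Prod.mk.injEq, and_true, not_and,
    forall_eq_or_imp, lt_irrefl, not_false_eq_true, implies_true, true_and]
  refine ⟨fun h => h.1.1, fun h => ⟨⟨h, fun hr => lt_irrefl _ (hlt _ hr)⟩, fun r hr _ =>
    not_lt.2 (hlt r hr).le⟩⟩

theorem isEmptyCell_insert_of_lt {n : ℕ} {p j : Fin n} {U : Finset ℕ}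
    {C : Finset (Fin n × Fin n)} {s : Fin n × Fin n} (hs : j < s.2) :
    ((s.1 : ℕ) ∉ U ∧ IsEmptyCell (insert (p, j) C) s) ↔
      ((s.1 : ℕ) ∉ insert (p : ℕ) U ∧ IsEmptyCell C s) := by
  have h1 : s ≠ (p, j) := fun h => by rw [h] at hs; exact lt_irrefl _ hs
  have h2 : ((s.1 : ℕ) = p) ↔ p = s.1 := by rw [Fin.ext_iff, eq_comm]
  simp only [IsEmptyCell, Finset.mem_insert, not_or, forall_eq_or_imp, hs, and_true, h1,
    not_false_eq_true, true_and, h2]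
  tauto

/-- Dworkin's statistic relative to a set `U` of occupied rows. -/
noncomputable def xiTail (n : ℕ) (c : Fin n → ℕ) (U : Finset ℕ)
    (C : Finset (Fin n × Fin n)) : ℕ :=
  ∑ r ∈ C,
    if r ∈ boardSq n c then
      ((boardSq n c).filter fun s =>
        s.2 = r.2 ∧ r.1 < s.1 ∧ (s.1 : ℕ) ∉ U ∧ IsEmptyCell C s).card
    else
      ((Finset.univ : Finset (Fin n × Fin n)).filter
          fun s => s.2 = r.2 ∧ r.1 < s.1 ∧ (s.1 : ℕ) ∉ U ∧ IsEmptyCell C s).card +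
        ((boardSq n c).filter fun s =>
          s.2 = r.2 ∧ s.1 < r.1 ∧ (s.1 : ℕ) ∉ U ∧ IsEmptyCell C s).card

theorem xiTail_empty_rows (n : ℕ) (c : Fin n → ℕ) (C : Finset (Fin n × Fin n)) :
    xiTail n c ∅ C = xiStat n c C := by
  simp only [xiTail, xiStat, Finset.notMem_empty, not_false_eq_true, true_and]

theorem xiTail_insert {n : ℕ} {c : Fin n → ℕ} (hc : ∀ j, c j ≤ n) {p j : Fin n}
    {U : Finset ℕ} {C : Finset (Fin n × Fin n)} (hp : (p : ℕ) ∉ U)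
    (hC : C ∈ tailPlacements n (j + 1) (insert (p : ℕ) U)) :
    xiTail n c U (insert (p, j) C) =
      (if (p : ℕ) < c j then freeRows U (c j) - 1 - freeRows U p
        else freeRows U (c j) + (freeRows U n - 1 - freeRows U p)) +
      xiTail n c (insert (p : ℕ) U) C := by
  rw [xiTail, Finset.sum_insert (notMem_of_tailPlacements hC), xiTail]
  congr 1
  · simp only [mem_boardSq]
    split_ifs with h
    · rw [← card_free_between (hc j) hp]
      refine card_column j _ _ fun s => ?_
      simp only [Finset.mem_filter, mem_boardSq]
      refine ⟨fun hs => ⟨hs.2.1, hs.2.2.1, hs.2.1 ▸ hs.1, hs.2.2.2.1⟩, fun hs =>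
        ⟨hs.1.symm ▸ hs.2.2.1, hs.1, hs.2.1, hs.2.2.2,
          (isEmptyCell_insert_of_column hC hs.1).2 fun e => ?_⟩⟩
      exact absurd hs.2.1 (by rw [e]; exact lt_irrefl _)
    · rw [add_comm]
      congr 1
      · rw [← card_free_lt (hc j)]
        refine card_column j _ _ fun s => ?_
        simp only [Finset.mem_filter, mem_boardSq]
        refine ⟨fun hs => ⟨hs.2.1, hs.2.1 ▸ hs.1, hs.2.2.2.1⟩, fun hs => ?_⟩
        have hsp : s.1 < p := Fin.lt_def.2 (lt_of_lt_of_le hs.2.1 (not_lt.1 h))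
        exact ⟨hs.1.symm ▸ hs.2.1, hs.1, hsp, hs.2.2,
          (isEmptyCell_insert_of_column hC hs.1).2 hsp.ne⟩
      · rw [← card_free_between le_rfl hp]
        refine card_column j _ _ fun s => ?_
        simp only [Finset.mem_filter, Finset.mem_univ, true_and]
        refine ⟨fun hs => ⟨hs.1, hs.2.1, s.1.2, hs.2.2.1⟩, fun hs =>
          ⟨hs.1, hs.2.1, hs.2.2.2, (isEmptyCell_insert_of_column hC hs.1).2 fun e => ?_⟩⟩
        exact absurd hs.2.1 (by rw [e]; exact lt_irrefl _)
  · refine Finset.sum_congr rfl fun r hr => ?_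
    have hlt : j < r.2 := ((mem_tailPlacements.1 hC).2 r hr).1
    have key (s : Fin n × Fin n) (hs : s.2 = r.2) :
        ((s.1 : ℕ) ∉ U ∧ IsEmptyCell (insert (p, j) C) s) ↔
          ((s.1 : ℕ) ∉ insert (p : ℕ) U ∧ IsEmptyCell C s) :=
      isEmptyCell_insert_of_lt (hs ▸ hlt)
    have hfilter (S : Finset (Fin n × Fin n)) (P : Fin n → Prop) [DecidablePred P] :
        (S.filter fun s =>
          s.2 = r.2 ∧ P s.1 ∧ (s.1 : ℕ) ∉ U ∧ IsEmptyCell (insert (p, j) C) s) =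
        S.filter fun s =>
          s.2 = r.2 ∧ P s.1 ∧ (s.1 : ℕ) ∉ insert (p : ℕ) U ∧ IsEmptyCell C s := by
      refine Finset.filter_congr fun s _ => and_congr_right fun hs => ?_
      rw [key s hs]
    rw [hfilter _ fun a => r.1 < a, hfilter _ fun a => r.1 < a, hfilter _ fun a => a < r.1]

/-- Garsia–Remmel inversions in the columns `≥ j`, relative to a set `U` of occupied rows. -/
noncomputable def invTail (n : ℕ) (c : Fin n → ℕ) (j : ℕ) (U : Finset ℕ)
    (C : Finset (Fin n × Fin n)) : ℕ :=
  ((boardSq n c).filter fun s => j ≤ (s.2 : ℕ) ∧ (s.1 : ℕ) ∉ U ∧ s ∉ C ∧ ∀ r ∈ C,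
    ¬(r.2 = s.2 ∧ s.1 < r.1) ∧ ¬(r.1 = s.1 ∧ r.2 < s.2)).card

theorem invTail_empty_rows (n : ℕ) (c : Fin n → ℕ) (C : Finset (Fin n × Fin n)) :
    invTail n c 0 ∅ C = rookInv n c C := by
  simp only [invTail, rookInv, Finset.notMem_empty, not_false_eq_true, true_and, zero_le]

theorem invTail_split {n : ℕ} (c : Fin n → ℕ) (j : Fin n) (U : Finset ℕ)
    (C : Finset (Fin n × Fin n)) :
    invTail n c j U C =
      ((boardSq n c).filter fun s => s.2 = j ∧ (s.1 : ℕ) ∉ U ∧ s ∉ C ∧ ∀ r ∈ C,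
        ¬(r.2 = s.2 ∧ s.1 < r.1) ∧ ¬(r.1 = s.1 ∧ r.2 < s.2)).card +
      invTail n c (j + 1) U C := by
  rw [invTail, invTail, ← Finset.card_union_of_disjoint]
  · congr 1
    ext s
    simp only [Finset.mem_filter, Finset.mem_union, Fin.ext_iff]
    have : (j : ℕ) ≤ s.2 ↔ ((s.2 : ℕ) = j ∨ (j : ℕ) + 1 ≤ s.2) := by omega
    rw [this]
    tauto
  · rw [Finset.disjoint_left]
    intro s hs hs'
    simp only [Finset.mem_filter] at hs hs'
    have := hs'.2.1
    rw [hs.2.1] at this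
    omega

theorem invTail_of_mem {n : ℕ} {c : Fin n → ℕ} (hc : ∀ j, c j ≤ n) {j : Fin n}
    {U : Finset ℕ} {C : Finset (Fin n × Fin n)} (hC : C ∈ tailPlacements n (j + 1) U) :
    invTail n c j U C = freeRows U (c j) + invTail n c (j + 1) U C := by
  rw [invTail_split]
  congr 1
  rw [← card_free_lt (hc j)]
  refine card_column j _ _ fun s => ?_
  have hlt (r) (hr : r ∈ C) : j < r.2 := ((mem_tailPlacements.1 hC).2 r hr).1
  simp only [Finset.mem_filter, mem_boardSq]
  refine ⟨fun hs => ⟨hs.2.1, hs.2.1 ▸ hs.1, hs.2.2.1⟩, fun hs =>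
    ⟨hs.1.symm ▸ hs.2.1, hs.1, hs.2.2, fun h => (hlt s h).ne' hs.1, fun r hr =>
      ⟨fun h => (hlt r hr).ne' (h.1.trans hs.1), fun h => ?_⟩⟩⟩
  have h2 := h.2
  rw [hs.1] at h2
  exact absurd h2 (hlt r hr).not_gt

theorem invTail_insert {n : ℕ} {c : Fin n → ℕ} (hc : ∀ j, c j ≤ n) {p j : Fin n}
    {U : Finset ℕ} {C : Finset (Fin n × Fin n)} (hp : (p : ℕ) ∉ U)
    (hC : C ∈ tailPlacements n (j + 1) (insert (p : ℕ) U)) :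
    invTail n c j U (insert (p, j) C) =
      (freeRows U (c j) - 1 - freeRows U p) + invTail n c (j + 1) (insert (p : ℕ) U) C := by
  have hlt (r) (hr : r ∈ C) : j < r.2 := ((mem_tailPlacements.1 hC).2 r hr).1
  rw [invTail_split]
  congr 1
  · rw [← card_free_between (hc j) hp]
    refine card_column j _ _ fun s => ?_
    simp only [Finset.mem_filter, mem_boardSq]
    constructor
    · rintro ⟨hb, hj, hU, hs, h⟩
      have h1 := (h _ (Finset.mem_insert_self _ _)).1
      have hne : s.1 ≠ p := fun e => hs (by
        rw [show s = (p, j) from Prod.ext e hj]; exact Finset.mem_insert_self _ _)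
      have h2 : ¬ s.1 < p := fun h' => h1 ⟨hj.symm, h'⟩
      exact ⟨hj, Fin.lt_def.1 (lt_of_le_of_ne (not_lt.1 h2) hne.symm), hj ▸ hb, hU⟩
    · rintro ⟨hj, hps, hb, hU⟩
      have hps' : p < s.1 := hps
      refine ⟨hj.symm ▸ hb, hj, hU, fun h => ?_, fun r hr => ?_⟩
      · rcases Finset.mem_insert.1 h with h | h
        · rw [h] at hps'
          exact lt_irrefl _ hps'
        · exact (hlt s h).ne' hj
      · rcases Finset.mem_insert.1 hr with rfl | hr
        · exact ⟨fun h => h.2.not_gt hps', fun h => hps'.ne h.1⟩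
        · refine ⟨fun h => (hlt r hr).ne' (h.1.trans hj), fun h => ?_⟩
          have h2 := h.2
          rw [hj] at h2
          exact absurd h2 (hlt r hr).not_gt
  · rw [invTail, invTail]
    congr 1
    refine Finset.filter_congr fun s _ => and_congr_right fun hs => ?_
    have hjs : j < s.2 := hs
    have h1 : s ≠ (p, j) := fun h => by rw [h] at hjs; exact lt_irrefl _ hjs
    have h2 : ((s.1 : ℕ) = p) ↔ p = s.1 := by rw [Fin.ext_iff, eq_comm]
    simp only [Finset.mem_insert, not_or, forall_eq_or_imp, hjs, and_true, h1,
      not_false_eq_true, true_and, h2, hjs.ne, false_and]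
    tauto

/-- Column heights extended by full columns to all of `ℕ`. -/
def extHeights (n : ℕ) (c : Fin n → ℕ) (i : ℕ) : ℕ := if h : i < n then c ⟨i, h⟩ else n

theorem extHeights_coe {n : ℕ} (c : Fin n → ℕ) (j : Fin n) : extHeights n c j = c j := by
  simp [extHeights]

theorem extHeights_le {n : ℕ} {c : Fin n → ℕ} (hc : ∀ j, c j ≤ n) (i : ℕ) :
    extHeights n c i ≤ n := by
  unfold extHeights
  split_ifs
  · exact hc _
  · exact le_rfl

theorem extHeights_mono {n : ℕ} {c : Fin n → ℕ} (hc : IsFerrers n c) :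
    Monotone (extHeights n c) := by
  intro a b hab
  by_cases hb : b < n
  · simp only [extHeights, hb, lt_of_le_of_lt hab hb, dif_pos]
    exact hc.1 hab
  · simp only [extHeights, hb, dif_neg, not_false_eq_true]
    exact extHeights_le hc.2 a

theorem sum_range_ite_lt {M : Type*} [AddCommMonoid M] {n e : ℕ} (h : e ≤ n)
    (f g : ℕ → M) :
    ∑ r ∈ Finset.range n, (if r < e then f r else g r) =
      ∑ r ∈ Finset.range e, f r + ∑ r ∈ Finset.Ico e n, g r := by
  rw [← Finset.sum_range_add_sum_Ico _ h]
  congr 1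
  · exact Finset.sum_congr rfl fun r hr => if_pos (Finset.mem_range.1 hr)
  · exact Finset.sum_congr rfl fun r hr => if_neg (Finset.mem_Ico.1 hr).1.not_gt

theorem sum_pow_invTail {R : Type*} [CommRing R] (q : R) {n : ℕ} {c : Fin n → ℕ}
    (hc : IsFerrers n c) (d j : ℕ) (hj : j + d = n) (U : Finset ℕ) (m : ℕ) :
    ∑ C ∈ tailPlacements n j U,
        (if C.card = m ∧ C ⊆ boardSq n c then q ^ invTail n c j U C else 0) =
      rookNum q d (fun i => freeRows U (extHeights n c (j + i))) m := by
  induction d generalizing j U m with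
  | zero =>
    have h0 : invTail n c j U ∅ = 0 := by
      rw [invTail, Finset.card_eq_zero, Finset.filter_eq_empty_iff]
      rintro s _ ⟨h, _⟩
      omega
    rw [tailPlacements_of_le (by omega), Finset.sum_singleton, h0]
    simp [rookNum, eq_comm]
  | succ d ih =>
    have hjn : j < n := by omega
    obtain ⟨jf, rfl⟩ : ∃ jf : Fin n, j = jf := ⟨⟨j, hjn⟩, rfl⟩
    have hshift (V : Finset ℕ) : (fun i => freeRows V (extHeights n c (jf + 1 + i))) =
        fun i => freeRows V (extHeights n c (jf + (i + 1))) := by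
      funext i; congr 2; omega
    have hskip : ∑ C ∈ tailPlacements n (jf + 1) U,
        (if C.card = m ∧ C ⊆ boardSq n c then q ^ invTail n c jf U C else 0) =
        q ^ freeRows U (c jf) *
          rookNum q d (fun i => freeRows U (extHeights n c (jf + (i + 1)))) m := by
      rw [← hshift, ← ih _ (by omega) U, Finset.mul_sum]
      refine Finset.sum_congr rfl fun C hC => ?_
      rw [invTail_of_mem hc.2 hC, pow_add, mul_ite, mul_zero]
    rw [sum_tailPlacements, hskip]
    rcases m with _ | m
    · rw [Finset.sum_eq_zero fun p hp => Finset.sum_eq_zero fun C hC => if_neg ?_]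
      · simp [rookNum, extHeights_coe]
      · simp
    · obtain ⟨G, hG⟩ : ∃ G : ℕ → R, G = fun r =>
          if r < freeRows U (c jf) then q ^ (freeRows U (c jf) - 1 - r) *
            rookNum q d (delRow r fun i => freeRows U (extHeights n c (jf + (i + 1)))) m
          else 0 := ⟨_, rfl⟩
      have hrook : ∀ p ∈ (Finset.univ : Finset (Fin n)).filter
            (fun p : Fin n => (p : ℕ) ∉ U),
          ∑ C ∈ tailPlacements n (jf + 1) (insert (p : ℕ) U),
            (if (insert (p, jf) C).card = m + 1 ∧ insert (p, jf) C ⊆ boardSq n c then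
              q ^ invTail n c jf U (insert (p, jf) C) else 0) =
          G (freeRows U p) := by
        intro p hp
        have hpU := (Finset.mem_filter.1 hp).2
        simp only [hG, freeRows_lt_iff hpU]
        rw [← freeRows_comp_insert hpU, ← hshift, ← ih _ (by omega), Finset.mul_sum]
        split_ifs with hpc
        · refine Finset.sum_congr rfl fun C hC => ?_
          rw [invTail_insert hc.2 hpU hC, pow_add,
            Finset.card_insert_of_notMem (notMem_of_tailPlacements hC)]
          simp [Finset.insert_subset_iff, mem_boardSq, hpc]
        · refine Finset.sum_eq_zero fun C hC => if_neg fun h => hpc ?_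
          exact mem_boardSq.1 (h.2 (Finset.mem_insert_self _ _))
      rw [Finset.sum_congr rfl hrook, sum_fin_freeRows, hG,
        sum_range_ite_lt (freeRows_mono U (hc.2 jf)), Finset.sum_const_zero, add_zero,
        rookNum, add_zero, extHeights_coe, add_comm, ← sum_pow_reflect, Finset.sum_mul]
      congr 1
      refine Finset.sum_congr rfl fun r hr => ?_
      rw [delRow_of_lt fun i => ?_]
      refine lt_of_lt_of_le (Finset.mem_range.1 hr) (freeRows_mono U ?_)
      rw [← extHeights_coe c jf]
      exact extHeights_mono hc (by omega)

theorem qRook_eq_rookNum {R : Type*} [CommRing R] (q : R) {n : ℕ} {c : Fin n → ℕ}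
    (hc : IsFerrers n c) (m : ℕ) : qRook q n c m = rookNum q n (extHeights n c) m := by
  have h := sum_pow_invTail q hc n 0 (zero_add n) ∅ m
  simp only [freeRows_empty, zero_add, invTail_empty_rows] at h
  rw [← h, ← Finset.sum_filter, qRook]
  refine Finset.sum_congr ?_ fun _ _ => rfl
  ext C
  simp only [placements, tailPlacements, Finset.mem_filter, Finset.mem_univ, true_and,
    zero_le, Finset.notMem_empty, not_false_eq_true, implies_true, and_true]
  tauto

theorem sum_pow_xiTail {R : Type*} [CommRing R] (q : R) {n : ℕ} {c : Fin n → ℕ}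
    (hc : IsFerrers n c) (d j : ℕ) (hj : j + d = n) (U : Finset ℕ)
    (hU : U ⊆ Finset.range n) (hUj : U.card = j) :
    ∑ C ∈ tailPlacements n j U,
        (if C.card = d then Polynomial.X ^ (C ∩ boardSq n c).card *
          Polynomial.C (q ^ xiTail n c U C) else 0) =
      hitPoly q d (fun i => freeRows U (extHeights n c (j + i))) := by
  induction d generalizing j U with
  | zero =>
    rw [tailPlacements_of_le (by omega), Finset.sum_singleton]
    simp [hitPoly, xiTail, qfact, rookNum]
  | succ d ih =>
    have hjn : j < n := by omega
    obtain ⟨jf, rfl⟩ : ∃ jf : Fin n, j = jf := ⟨⟨j, hjn⟩, rfl⟩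
    have hshift (V : Finset ℕ) : (fun i => freeRows V (extHeights n c (jf + 1 + i))) =
        fun i => freeRows V (extHeights n c (jf + (i + 1))) := by
      funext i; congr 2; omega
    have hn : freeRows U n = d + 1 := by rw [freeRows_eq_sub hU]; omega
    have hskip : ∑ C ∈ tailPlacements n (jf + 1) U,
        (if C.card = d + 1 then Polynomial.X ^ (C ∩ boardSq n c).card *
          Polynomial.C (q ^ xiTail n c U C) else 0) = 0 := by
      refine Finset.sum_eq_zero fun C hC => if_neg ?_
      have := card_le_of_mem_tailPlacements hC
      omega
    obtain ⟨G, hG⟩ : ∃ G : ℕ → Polynomial R, G = fun r =>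
        if r < freeRows U (c jf) then
          Polynomial.X * Polynomial.C (q ^ (freeRows U (c jf) - 1 - r)) *
            hitPoly q d (delRow r fun i => freeRows U (extHeights n c (jf + (i + 1))))
        else Polynomial.C (q ^ (freeRows U (c jf) + (d - r))) *
          hitPoly q d (delRow r fun i => freeRows U (extHeights n c (jf + (i + 1)))) :=
      ⟨_, rfl⟩
    have hrook : ∀ p ∈ (Finset.univ : Finset (Fin n)).filter
          (fun p : Fin n => (p : ℕ) ∉ U),
        ∑ C ∈ tailPlacements n (jf + 1) (insert (p : ℕ) U),
          (if (insert (p, jf) C).card = d + 1 then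
            Polynomial.X ^ (insert (p, jf) C ∩ boardSq n c).card *
              Polynomial.C (q ^ xiTail n c U (insert (p, jf) C)) else 0) =
        G (freeRows U p) := by
      intro p hp
      have hpU := (Finset.mem_filter.1 hp).2
      simp only [hG, freeRows_lt_iff hpU]
      rw [← freeRows_comp_insert hpU, ← hshift, ← ih _ (by omega) _
        (Finset.insert_subset (by simp) hU) (by rw [Finset.card_insert_of_notMem hpU, hUj]),
        Finset.mul_sum, Finset.mul_sum, ← Finset.sum_ite_irrel]
      refine Finset.sum_congr rfl fun C hC => ?_
      have hpC := notMem_of_tailPlacements (p := p) hC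
      rw [xiTail_insert hc.2 hpU hC, Finset.card_insert_of_notMem hpC, hn,
        Nat.add_sub_cancel]
      by_cases hcard : C.card = d
      · by_cases hpc : (p : ℕ) < c jf
        · rw [Finset.insert_inter_of_mem (mem_boardSq.2 hpc), Finset.card_insert_of_notMem
            fun h => hpC (Finset.mem_inter.1 h).1]
          simp only [hcard, hpc, if_true, pow_add, map_mul]
          ring
        · rw [Finset.insert_inter_of_notMem fun h => hpc (mem_boardSq.1 h)]
          simp only [hcard, hpc, if_true, if_false, pow_add, map_mul]
          ring
      · simp [hcard]
    have hmono : Monotone fun i => freeRows U (extHeights n c (jf + i)) :=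
      fun a b h => freeRows_mono U (extHeights_mono hc (by omega))
    have hle (i : ℕ) : freeRows U (extHeights n c (jf + i)) ≤ d + 1 :=
      hn ▸ freeRows_mono U (extHeights_le hc.2 _)
    rw [sum_tailPlacements, hskip, zero_add, Finset.sum_congr rfl hrook, sum_fin_freeRows, hn, hG,
      sum_range_ite_lt (hn ▸ freeRows_mono U (hc.2 jf)),
      hitPoly_succ q d _ hmono hle]
    simp only [add_zero, extHeights_coe]
    congr 1
    rw [← sum_pow_reflect, map_sum, Finset.mul_sum, Finset.sum_mul]
    refine Finset.sum_congr rfl fun r hr => ?_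
    rw [delRow_of_lt fun i => ?_]
    refine lt_of_lt_of_le (Finset.mem_range.1 hr) (freeRows_mono U ?_)
    rw [← extHeights_coe c jf]
    exact extHeights_mono hc (by omega)

theorem statement7 {R : Type*} [CommRing R] (q : R) (n : ℕ) (c : Fin n → ℕ)
    (hc : IsFerrers n c) (k : ℕ) :
    qHit q n c k = ∑ C ∈ fullPlacements n c k, q ^ xiStat n c C := by
  have h := sum_pow_xiTail q hc n 0 (zero_add n) ∅ (Finset.empty_subset _) rfl
  simp only [freeRows_empty, zero_add, xiTail_empty_rows] at h
  have hgen : hitGen q n c = hitPoly q n (extHeights n c) := by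
    simp only [hitGen, hitPoly, qRook_eq_rookNum q hc]
  rw [qHit, hgen, ← h, Polynomial.finsetSum_coeff]
  have hcoeff (C : Finset (Fin n × Fin n)) :
      (if C.card = n then Polynomial.X ^ (C ∩ boardSq n c).card *
        Polynomial.C (q ^ xiStat n c C) else 0).coeff k =
      if C.card = n ∧ (C ∩ boardSq n c).card = k then q ^ xiStat n c C else 0 := by
    by_cases h1 : C.card = n
    · simp only [h1, if_true, true_and, Polynomial.coeff_mul_C, Polynomial.coeff_X_pow,
        ite_mul, one_mul, zero_mul, eq_comm (a := k)]
    · simp [h1]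
  simp only [hcoeff]
  rw [← Finset.sum_filter]
  refine Finset.sum_congr ?_ fun _ _ => rfl
  ext C
  simp only [fullPlacements, tailPlacements, Finset.mem_filter, Finset.mem_univ, true_and,
    zero_le, Finset.notMem_empty, not_false_eq_true, implies_true, and_true]
  tauto
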